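/- Let (X, 𝓑, μ) be a probability space and let T₁, …, T_k be pairwise commuting measurable measure-preserving maps on X. Suppose that for every B ∈ 𝓑 with μ(B) > 0 there is n ≥ 1 such that μ(⋂_{1≤i≤k} T_i^{-n}(B)) > 0. Then for every A ∈ 𝓑 with μ(A) > 0 and μ-almost every x ∈ A, there is n ≥ 1 such that x ∈ ⋂_{1≤i≤k} T_i^{-n}(A). -/

import Mathlib

open MeasureTheory

namespace DensityHalesJewett

open Combinatorics

/-- The average of a real function over a finite type. -/
noncomputable def mean {β : Type} [Finite β] (f : β → ℝ) : ℝ :=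
  letI := Fintype.ofFinite β
  (∑ x, f x) / Nat.card β

section Mean

variable {β γ : Type} [Finite β] [Finite γ]

lemma mean_eq [Fintype β] (f : β → ℝ) : mean f = (∑ x, f x) / Nat.card β := by
  unfold mean
  congr!

lemma mean_mono {f g : β → ℝ} (h : ∀ x, f x ≤ g x) : mean f ≤ mean g := by
  have := Fintype.ofFinite β
  rw [mean_eq, mean_eq]
  gcongr
  exact h _

lemma mean_const [Nonempty β] (c : ℝ) : mean (fun _ : β ↦ c) = c := by
  have := Fintype.ofFinite β
  have : (Nat.card β : ℝ) ≠ 0 := by exact_mod_cast Nat.card_pos.ne'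
  rw [mean_eq]
  simp only [Finset.sum_const, Finset.card_univ, nsmul_eq_mul, ← Nat.card_eq_fintype_card]
  field_simp

lemma mean_nonneg {f : β → ℝ} (h : ∀ x, 0 ≤ f x) : 0 ≤ mean f := by
  have := Fintype.ofFinite β
  rw [mean_eq]
  have := Finset.sum_nonneg (s := Finset.univ) fun x _ ↦ h x
  positivity

lemma le_mean [Nonempty β] {f : β → ℝ} {c : ℝ} (h : ∀ x, c ≤ f x) : c ≤ mean f :=
  (mean_const c).symm.trans_le (mean_mono h)

lemma exists_le_of_le_mean [Nonempty β] {f : β → ℝ} {c : ℝ} (h : c ≤ mean f) :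
    ∃ x, c ≤ f x := by
  have := Fintype.ofFinite β
  by_contra! hlt
  have hc : (0 : ℝ) < Nat.card β := by exact_mod_cast Nat.card_pos
  have h1 : ∑ x, f x < ∑ _x : β, c :=
    Finset.sum_lt_sum_of_nonempty Finset.univ_nonempty fun x _ ↦ hlt x
  rw [mean_eq, le_div_iff₀ hc] at h
  simp only [Finset.sum_const, Finset.card_univ, nsmul_eq_mul, ← Nat.card_eq_fintype_card] at h1
  linarith

lemma mean_add (f g : β → ℝ) : mean (fun x ↦ f x + g x) = mean f + mean g := by
  have := Fintype.ofFinite β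
  simp only [mean_eq, Finset.sum_add_distrib, add_div]

lemma mean_sub (f g : β → ℝ) : mean (fun x ↦ f x - g x) = mean f - mean g := by
  have := Fintype.ofFinite β
  simp only [mean_eq, Finset.sum_sub_distrib, sub_div]

lemma mean_const_mul (c : ℝ) (f : β → ℝ) : mean (fun x ↦ c * f x) = c * mean f := by
  have := Fintype.ofFinite β
  simp only [mean_eq, ← Finset.mul_sum, mul_div_assoc]

lemma mean_sum {τ : Type} (s : Finset τ) (f : τ → β → ℝ) :
    mean (fun x ↦ ∑ t ∈ s, f t x) = ∑ t ∈ s, mean (f t) := by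
  have := Fintype.ofFinite β
  simp only [mean_eq]
  rw [Finset.sum_comm, Finset.sum_div]

lemma mean_equiv (e : β ≃ γ) (f : γ → ℝ) : mean (fun x ↦ f (e x)) = mean f := by
  have := Fintype.ofFinite β
  have := Fintype.ofFinite γ
  rw [mean_eq, mean_eq, Nat.card_congr e, Equiv.sum_comp e f]

lemma mean_prod (f : β × γ → ℝ) : mean f = mean fun x ↦ mean fun y ↦ f (x, y) := by
  have := Fintype.ofFinite β
  have := Fintype.ofFinite γ
  simp only [mean_eq, Fintype.sum_prod_type, Nat.card_prod, ← Finset.sum_div]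
  push_cast
  rw [div_div, mul_comm]

lemma mean_comm (f : β → γ → ℝ) :
    mean (fun x ↦ mean fun y ↦ f x y) = mean fun y ↦ mean fun x ↦ f x y := by
  rw [← mean_prod (fun p ↦ f p.1 p.2), ← mean_prod (fun p ↦ f p.2 p.1),
    ← mean_equiv (Equiv.prodComm β γ)]
  rfl

lemma mean_sumElim {ι κ α : Type} [Finite ι] [Finite κ] [Finite α] (f : (ι ⊕ κ → α) → ℝ) :
    mean f = mean fun x : ι → α ↦ mean fun y : κ → α ↦ f (Sum.elim x y) := by
  rw [← mean_equiv (Equiv.sumArrowEquivProdArrow ι κ α).symm, mean_prod]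
  rfl

lemma mean_update {L : Type} [Finite L] [Nonempty β] [DecidableEq L] (l : L)
    (f : (L → β) → ℝ) : mean f = mean fun u ↦ mean fun x ↦ f (Function.update u l x) := by
  rw [← mean_equiv (Equiv.funSplitAt l β).symm,
    ← mean_equiv (Equiv.funSplitAt l β).symm (fun u ↦ mean fun x ↦ f (Function.update u l x)),
    mean_prod, mean_prod]
  have key (x : β) (y : β) (z : {j // j ≠ l} → β) :
      Function.update ((Equiv.funSplitAt l β).symm (x, z)) l y =
        (Equiv.funSplitAt l β).symm (y, z) := by
    ext j
    rcases eq_or_ne j l with rfl | h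
    · simp [Equiv.funSplitAt, Equiv.piSplitAt]
    · simp [Equiv.funSplitAt, Equiv.piSplitAt, h]
  simp only [key, mean_const]
  exact mean_comm _

/-- The mean over an injective image, rescaled. -/
lemma mean_indicator_range (V : β → γ) (hV : Function.Injective V) (g : γ → ℝ) :
    mean ((Set.range V).indicator g) =
      (Nat.card β / Nat.card γ : ℝ) * mean fun w ↦ g (V w) := by
  classical
  have := Fintype.ofFinite β
  have := Fintype.ofFinite γ
  rcases isEmpty_or_nonempty β with hβ | hβ
  · have : Set.range V = ∅ := Set.range_eq_empty V
    rw [this]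
    simp [mean_eq]
  have hc : (Nat.card β : ℝ) ≠ 0 := by exact_mod_cast Nat.card_pos.ne'
  have h1 : ∑ x, (Set.range V).indicator g x = ∑ w, g (V w) := by
    rw [← Finset.sum_image (s := Finset.univ) (g := V) (f := g) (fun _ _ _ _ h ↦ hV h)]
    rw [Finset.sum_indicator_eq_sum_filter]
    congr 1
    ext; simp
  rw [mean_eq, mean_eq, h1]
  field_simp

end Mean

/-- The density of a set in a finite type. -/
noncomputable def dens {β : Type} [Finite β] (A : Set β) : ℝ := mean (A.indicator fun _ ↦ 1)

section Dens

variable {β γ : Type} [Finite β] [Finite γ]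

lemma dens_nonneg (A : Set β) : 0 ≤ dens A :=
  mean_nonneg fun _ ↦ Set.indicator_nonneg (fun _ _ ↦ zero_le_one) _

lemma dens_mono {A B : Set β} (h : A ⊆ B) : dens A ≤ dens B :=
  mean_mono fun _ ↦ Set.indicator_le_indicator_of_subset h (fun _ ↦ zero_le_one) _

lemma dens_univ [Nonempty β] : dens (Set.univ : Set β) = 1 := by
  simp [dens, mean_const]

lemma dens_le_one [Nonempty β] (A : Set β) : dens A ≤ 1 :=
  (dens_mono (Set.subset_univ A)).trans_eq dens_univ

lemma nonempty_of_dens_pos {A : Set β} (h : 0 < dens A) : A.Nonempty := by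
  by_contra hA
  rw [Set.not_nonempty_iff_eq_empty] at hA
  have := Fintype.ofFinite β
  simp [hA, dens, mean_eq] at h

lemma dens_equiv (e : β ≃ γ) (A : Set γ) : dens (e ⁻¹' A) = dens A :=
  mean_equiv e (A.indicator fun _ ↦ 1)

lemma dens_prod (A : Set (β × γ)) : dens A = mean fun x ↦ dens {y | (x, y) ∈ A} :=
  mean_prod _

lemma dens_sumElim {ι κ α : Type} [Finite ι] [Finite κ] [Finite α] (A : Set (ι ⊕ κ → α)) :
    dens A = mean fun y : κ → α ↦ dens {x : ι → α | Sum.elim x y ∈ A} := by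
  rw [dens, mean_sumElim, mean_comm]
  rfl

lemma half_le_dens_of_le_mean [Nonempty β] {g : β → ℝ} (hg : ∀ x, g x ≤ 1) {b : ℝ} (hb : 0 ≤ b)
    (h : b ≤ mean g) : b / 2 ≤ dens {x | b / 2 ≤ g x} := by
  have : mean g ≤ mean fun x ↦ ({x | b / 2 ≤ g x}.indicator (fun _ ↦ 1) x : ℝ) + b / 2 := by
    refine mean_mono fun x ↦ ?_
    by_cases hx : b / 2 ≤ g x
    · simp only [Set.indicator, Set.mem_ofPred_eq, hx, if_true]
      linarith [hg x]
    · simp only [Set.indicator, Set.mem_ofPred_eq, hx, if_false]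
      linarith
  rw [mean_add, mean_const] at this
  unfold dens
  linarith

lemma exists_le_dens_of_subset_iUnion {τ : Type} [Finite τ] {S : Set β} {F : τ → Set β} {b : ℝ}
    (hb : 0 < b) (hS : b ≤ dens S) (h : S ⊆ ⋃ t, F t) :
    ∃ t, b / (Nat.card τ + 1) ≤ dens (F t) := by
  have := Fintype.ofFinite τ
  by_contra! hlt
  have h1 : dens S ≤ ∑ t, dens (F t) := by
    simp only [dens]
    rw [← mean_sum]
    refine mean_mono fun x ↦ ?_
    have hnn : ∀ t, 0 ≤ (F t).indicator (fun _ ↦ (1 : ℝ)) x :=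
      fun t ↦ Set.indicator_nonneg (fun _ _ ↦ zero_le_one) _
    by_cases hx : x ∈ S
    · obtain ⟨t, ht⟩ := Set.mem_iUnion.1 (h hx)
      refine le_trans ?_ (Finset.single_le_sum (fun t _ ↦ hnn t) (Finset.mem_univ t))
      simp [hx, ht]
    · simp only [Set.indicator, hx, if_false]
      exact Finset.sum_nonneg fun t _ ↦ hnn t
  have h2 : ∑ t, dens (F t) ≤ ∑ _t : τ, b / (Nat.card τ + 1) :=
    Finset.sum_le_sum fun t _ ↦ (hlt t).le
  simp only [Finset.sum_const, Finset.card_univ, nsmul_eq_mul, ← Nat.card_eq_fintype_card] at h2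
  have h3 : (Nat.card τ : ℝ) * (b / (Nat.card τ + 1)) < b := by
    rw [← mul_div_assoc, div_lt_iff₀ (by positivity)]
    nlinarith
  linarith

end Dens

section Subspaces

variable {η κ ι α : Type}

instance [Finite η] [Finite α] [Finite ι] : Finite (Subspace η α ι) :=
  Finite.of_injective Subspace.idxFun fun _ _ h ↦ Subspace.ext h

lemma subspace_injective (V : Subspace η α ι) :
    Function.Injective (V : (η → α) → ι → α) := by
  intro x y h
  ext e
  obtain ⟨i, hi⟩ := V.proper e
  have := congrFun h i
  rwa [V.apply_inr hi, V.apply_inr hi] at this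

/-- Composition of combinatorial subspaces. -/
def comp (V : Subspace κ α ι) (W : Subspace η α κ) : Subspace η α ι where
  idxFun i := (V.idxFun i).elim Sum.inl W.idxFun
  proper e := by
    obtain ⟨j, hj⟩ := W.proper e
    obtain ⟨i, hi⟩ := V.proper j
    exact ⟨i, by simp [hi, hj]⟩

lemma comp_apply (V : Subspace κ α ι) (W : Subspace η α κ) (y : η → α) :
    comp V W y = V (W y) := by
  ext i
  cases h : V.idxFun i <;> simp [comp, Subspace.coe_apply, h]

/-- The combinatorial subspace fixing the second half of the coordinates. -/
def fixRight (z : κ → α) : Subspace ι α (ι ⊕ κ) where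
  idxFun := Sum.elim Sum.inr fun j ↦ Sum.inl (z j)
  proper e := ⟨Sum.inl e, rfl⟩

lemma fixRight_apply (z : κ → α) (x : ι → α) : fixRight z x = Sum.elim x z := by
  ext (i | j) <;> rfl

/-- The combinatorial subspace fixing the first half of the coordinates. -/
def fixLeft (z : κ → α) : Subspace ι α (κ ⊕ ι) where
  idxFun := Sum.elim (fun j ↦ Sum.inl (z j)) Sum.inr
  proper e := ⟨Sum.inr e, rfl⟩

lemma fixLeft_apply (z : κ → α) (x : ι → α) : fixLeft z x = Sum.elim z x := by
  ext (i | j) <;> rfl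

end Subspaces

/-- Every subset of `ι → α` of density at least `δ` contains an `η`-dimensional subspace. -/
def DenseContains (η α ι : Type) [Finite α] [Finite ι] (δ : ℝ) : Prop :=
  ∀ A : Set (ι → α), δ ≤ dens A → ∃ V : Subspace η α ι, ∀ y, V y ∈ A

/-- Density Hales-Jewett over `α`, with subspaces of dimension `η`. -/
def DHJ (η α : Type) [Finite α] : Prop :=
  ∀ δ : ℝ, 0 < δ → ∃ (ι : Type) (_ : Finite ι), DenseContains η α ι δ

section Multidimensional

variable {η κ ι α : Type} [Finite α] [Finite ι] [Finite κ]

lemma DenseContains.sum [Nonempty α] {δ : ℝ} (h : DenseContains η α ι δ) :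
    DenseContains η α (ι ⊕ κ) δ := by
  intro A hA
  rw [dens_sumElim] at hA
  obtain ⟨z, hz⟩ := exists_le_of_le_mean hA
  obtain ⟨V, hV⟩ := h _ hz
  refine ⟨comp (fixRight z) V, fun y ↦ ?_⟩
  rw [comp_apply, fixRight_apply]
  exact hV y

lemma DenseContains.congr {δ : ℝ} (e : ι ≃ κ) (h : DenseContains η α ι δ) :
    DenseContains η α κ δ := by
  intro A hA
  obtain ⟨V, hV⟩ := h ((e.arrowCongr (Equiv.refl α)) ⁻¹' A) (by rwa [dens_equiv])
  refine ⟨V.reindex (Equiv.refl _) (Equiv.refl _) e, fun y ↦ ?_⟩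
  convert Set.mem_preimage.1 (hV y) using 1
  ext i
  simp [Equiv.arrowCongr]

lemma DenseContains.of_card_le [Nonempty α] {δ : ℝ} (h : DenseContains η α ι δ)
    (hc : Nat.card ι ≤ Nat.card κ) : DenseContains η α κ δ := by
  obtain ⟨n, hn⟩ := Nat.exists_eq_add_of_le hc
  obtain ⟨e⟩ : Nonempty (ι ⊕ Fin n ≃ κ) := Finite.card_eq.1 (by simp [hn])
  exact h.sum.congr e

lemma DenseContains.option [Nonempty α] {δ : ℝ} (hδ : 0 < δ)
    (h₁ : DenseContains Unit α ι (δ / 2))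
    (h₂ : DenseContains η α κ (δ / 2 / (Nat.card (Subspace Unit α ι) + 1))) :
    DenseContains (Option η) α (ι ⊕ κ) δ := by
  intro A hA
  rw [dens_sumElim] at hA
  obtain ⟨l, hl⟩ := exists_le_dens_of_subset_iUnion (by positivity)
    (half_le_dens_of_le_mean (fun _ ↦ dens_le_one _) hδ.le hA)
    (F := fun l : Subspace Unit α ι ↦ {y | ∀ w, Sum.elim (l w) y ∈ A})
    (fun y hy ↦ Set.mem_iUnion.2 (h₁ _ hy))
  obtain ⟨W, hW⟩ := h₂ _ hl
  refine ⟨⟨Sum.elim (fun i ↦ (l.idxFun i).map id fun _ ↦ none)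
    fun j ↦ (W.idxFun j).map id some, ?_⟩, fun y ↦ ?_⟩
  · rintro (_ | e)
    · obtain ⟨i, hi⟩ := l.proper ()
      exact ⟨Sum.inl i, by simp [hi]⟩
    · obtain ⟨j, hj⟩ := W.proper e
      exact ⟨Sum.inr j, by simp [hj]⟩
  · convert hW (fun e ↦ y (some e)) (fun _ ↦ y none) using 1
    ext (i | j)
    · cases h : l.idxFun i <;> simp [Subspace.coe_apply, h]
    · cases h : W.idxFun j <;> simp [Subspace.coe_apply, h]

lemma DHJ.multidimensional [Nonempty α] (h : DHJ Unit α) (η : Type) [Finite η] : DHJ η α := by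
  induction η using Finite.induction_empty_option with
  | of_equiv e ih =>
    intro δ hδ
    obtain ⟨ι, _, hι⟩ := ih δ hδ
    refine ⟨ι, ‹_›, fun A hA ↦ ?_⟩
    obtain ⟨V, hV⟩ := hι A hA
    refine ⟨V.reindex e (Equiv.refl _) (Equiv.refl _), fun y ↦ ?_⟩
    convert hV (y ∘ e) using 1
    ext i
    simp
  | h_empty =>
    intro δ hδ
    refine ⟨Empty, inferInstance, fun A hA ↦ ?_⟩
    obtain ⟨x, hx⟩ := nonempty_of_dens_pos (hδ.trans_le hA)
    refine ⟨⟨isEmptyElim, fun e ↦ e.elim⟩, fun y ↦ ?_⟩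
    convert hx using 1
  | h_option ih =>
    intro δ hδ
    obtain ⟨ι, _, hι⟩ := h (δ / 2) (by positivity)
    obtain ⟨κ, _, hκ⟩ := ih (δ / 2 / (Nat.card (Subspace Unit α ι) + 1)) (by positivity)
    exact ⟨ι ⊕ κ, inferInstance, hι.option hδ hκ⟩

end Multidimensional

section Insensitive

variable {η κ ι α : Type} [Finite α] [Finite ι] [Finite κ]

lemma dens_eq_ncard {β : Type} [Finite β] (A : Set β) : dens A = A.ncard / Nat.card β := by
  classical
  have := Fintype.ofFinite β
  rw [dens, mean_eq, Set.ncard_eq_toFinset_card', Finset.sum_indicator_eq_sum_filter]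
  simp only [Finset.sum_const, nsmul_eq_mul, mul_one]
  congr! 2
  congr 1
  ext; simp

/-- A set of words is insensitive if it is stable under exchanging the letter `none` with
the letter `some a`. -/
def Insensitive (a : α) (E : Set (ι → Option α)) : Prop :=
  ∀ x y, (∀ i, (x i).getD a = (y i).getD a) → x ∈ E → y ∈ E

/-- Dense insensitive sets contain subspaces over the larger alphabet. -/
lemma exists_subspace_of_insensitive (a : α) (h : DHJ η α) {β : ℝ} (hβ : 0 < β) :
    ∃ (ι : Type) (_ : Finite ι), ∀ E : Set (ι → Option α), Insensitive a E → β ≤ dens E →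
      ∃ V : Subspace η (Option α) ι, ∀ y, V y ∈ E := by
  classical
  have : Nonempty α := ⟨a⟩
  have := Fintype.ofFinite α
  obtain ⟨ι₀, _, h₀⟩ := h (β / 2) (by positivity)
  set m := Nat.card ι₀ with hm
  set k := Fintype.card α with hk
  have hkpos : (0 : ℝ) < k := by exact_mod_cast Fintype.card_pos
  have hr : ((k : ℝ) / 2 + 1) / (k + 1) < 1 := by
    rw [div_lt_one (by positivity)]
    linarith
  obtain ⟨n, hn⟩ := exists_pow_lt_of_lt_one (show (0 : ℝ) < β / 2 / 2 ^ m by positivity) hr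
  refine ⟨Fin n, inferInstance, fun E hE hdE ↦ ?_⟩
  by_contra! hno
  set supp : (Fin n → Option α) → Finset (Fin n) := fun z ↦ {i | z i ≠ none} with hsupp
  set word : (S : Finset (Fin n)) → (S → α) → Fin n → Option α :=
    fun S y i ↦ if hi : i ∈ S then some (y ⟨i, hi⟩) else none with hword
  have hsmall (S : Finset (Fin n)) (hS : m ≤ S.card) : dens {y : S → α | word S y ∈ E} < β / 2 := by
    by_contra! hlarge
    obtain ⟨V, hV⟩ := h₀.of_card_le (κ := S) (by simpa using hS) _ hlarge
    let V' : Subspace η (Option α) (Fin n) :=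
      { idxFun := fun i ↦ if hi : i ∈ S then (V.idxFun ⟨i, hi⟩).map some id else Sum.inl none
        proper := fun e ↦ by
          obtain ⟨i, hi⟩ := V.proper e
          exact ⟨i, by simp [hi]⟩ }
    obtain ⟨y, hy⟩ := hno V'
    refine hy (hE _ _ (fun i ↦ ?_) (hV fun e ↦ (y e).getD a))
    by_cases hi : i ∈ S
    · cases hc : V.idxFun ⟨i, hi⟩ <;> simp [hword, V', Subspace.coe_apply, hi, hc]
    · simp [hword, V', Subspace.coe_apply, hi]
  have hle (S : Finset (Fin n)) : ((Finset.univ.filter fun z ↦ z ∈ E ∧ supp z = S).card : ℝ) ≤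
      Set.ncard {y : S → α | word S y ∈ E} := by
    rw [Set.ncard_eq_toFinset_card']
    norm_cast
    refine Finset.card_le_card_of_injOn (fun z i ↦ (z i).getD a) ?_ ?_
    · intro z hz
      simp only [Finset.coe_filter, Finset.mem_univ, true_and, Set.mem_ofPred_eq] at hz
      simp only [Set.coe_toFinset, Set.mem_ofPred_eq]
      convert hz.1 using 1
      ext1 i
      have : i ∈ S ↔ z i ≠ none := by simp [← hz.2, hsupp]
      by_cases hi : i ∈ S
      · obtain ⟨b, hb⟩ := Option.ne_none_iff_exists'.1 (this.1 hi)
        simp [hword, hi, hb]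
      · have : z i = none := by tauto
        simp [hword, hi, this]
    · intro z hz w hw hzw
      simp only [Finset.coe_filter, Finset.mem_univ, true_and, Set.mem_ofPred_eq] at hz hw
      ext1 i
      have h1 : i ∈ S ↔ z i ≠ none := by simp [← hz.2, hsupp]
      have h2 : i ∈ S ↔ w i ≠ none := by simp [← hw.2, hsupp]
      by_cases hi : i ∈ S
      · obtain ⟨b, hb⟩ := Option.ne_none_iff_exists'.1 (h1.1 hi)
        obtain ⟨c, hc⟩ := Option.ne_none_iff_exists'.1 (h2.1 hi)
        have := congrFun hzw ⟨i, hi⟩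
        simp_all
      · have h1 : z i = none := by tauto
        have h2 : w i = none := by tauto
        rw [h1, h2]
  have hbound (S : Finset (Fin n)) :
      ((Finset.univ.filter fun z ↦ z ∈ E ∧ supp z = S).card : ℝ) ≤
        β / 2 * (k ^ S.card * 1 ^ (Fintype.card (Fin n) - S.card)) +
          2 ^ m * ((k / 2) ^ S.card * 1 ^ (Fintype.card (Fin n) - S.card)) := by
    have hdens := dens_eq_ncard {y : S → α | word S y ∈ E}
    have hcard : (Nat.card (S → α) : ℝ) = k ^ S.card := by simp [hk]
    rw [hcard, eq_div_iff (by positivity)] at hdens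
    refine (hle S).trans ?_
    rw [← hdens]
    simp only [one_pow, mul_one]
    by_cases hS : m ≤ S.card
    · have := hsmall S hS
      have : dens {y : S → α | word S y ∈ E} * (k : ℝ) ^ S.card ≤ β / 2 * k ^ S.card := by gcongr
      have : (0 : ℝ) ≤ 2 ^ m * (k / 2) ^ S.card := by positivity
      linarith
    · have h1 := dens_le_one {y : S → α | word S y ∈ E}
      have h2 : dens {y : S → α | word S y ∈ E} * (k : ℝ) ^ S.card ≤ 1 * k ^ S.card := by gcongr
      have h3 : (0 : ℝ) ≤ β / 2 * k ^ S.card := by positivity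
      have h4 : (2 : ℝ) ^ S.card ≤ 2 ^ m := pow_le_pow_right₀ one_le_two (by omega)
      have h5 : (k : ℝ) ^ S.card = 2 ^ S.card * (k / 2) ^ S.card := by
        rw [← mul_pow]
        congr 1
        ring
      have h6 : (2 : ℝ) ^ S.card * (k / 2) ^ S.card ≤ 2 ^ m * (k / 2) ^ S.card := by gcongr
      linarith
  have htotal : ((Finset.univ.filter (· ∈ E)).card : ℝ) =
      ∑ S, ((Finset.univ.filter fun z ↦ z ∈ E ∧ supp z = S).card : ℝ) := by
    rw [Finset.card_eq_sum_card_fiberwise (f := supp) (t := Finset.univ) (fun _ _ ↦ by simp)]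
    push_cast
    simp only [Finset.filter_filter]
  have hsum := Finset.sum_le_sum fun S (_ : S ∈ Finset.univ) ↦ hbound S
  rw [← htotal, Finset.sum_add_distrib, ← Finset.mul_sum, ← Finset.mul_sum,
    Fintype.sum_pow_mul_eq_add_pow, Fintype.sum_pow_mul_eq_add_pow] at hsum
  have hE' : β * (k + 1) ^ n ≤ ((Finset.univ.filter (· ∈ E)).card : ℝ) := by
    rw [dens_eq_ncard, le_div_iff₀ (by exact_mod_cast Nat.card_pos)] at hdE
    have hcard : (Nat.card (Fin n → Option α) : ℝ) = (k + 1) ^ n := by simp [hk]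
    rw [hcard, Set.ncard_eq_toFinset_card'] at hdE
    have hfilter : Finset.univ.filter (· ∈ E) = E.toFinset := by
      ext
      simp
    rwa [hfilter]
  rw [div_pow, div_lt_iff₀ (by positivity)] at hn
  have : (2 : ℝ) ^ m * ((k : ℝ) / 2 + 1) ^ n < β / 2 * (k + 1) ^ n := by
    calc (2 : ℝ) ^ m * ((k : ℝ) / 2 + 1) ^ n < 2 ^ m * (β / 2 / 2 ^ m * (k + 1) ^ n) := by gcongr
      _ = β / 2 * (k + 1) ^ n := by field_simp
  simp only [Fintype.card_fin] at hsum
  linarith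

end Insensitive

lemma Insensitive.preimage {η ι K : Type} {a : K} {E : Set (ι → Option K)} (hE : Insensitive a E)
    (V : Subspace η (Option K) ι) : Insensitive a {y | V y ∈ E} := by
  intro x y hxy hx
  refine hE _ _ (fun i ↦ ?_) hx
  cases h : V.idxFun i <;> simp [Subspace.coe_apply, h, hxy]

section Increment

variable {η ι κ α : Type} [Finite η] [Finite α] [Finite ι] [Finite κ]

/-- Every function bounded by `1` whose averages over all `η`-dimensional subspaces are at most `b`
has integral at most `(b + r) * dens E + β` over each set `E` insensitive at `a`. -/
def InsensitiveBound (η ι : Type) [Finite η] [Finite ι] (a : α) (r β : ℝ) : Prop :=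
  ∀ f : (ι → Option α) → ℝ, (∀ x, f x ≤ 1) → ∀ b : ℝ, 0 ≤ b →
    (∀ V : Subspace η (Option α) ι, mean (fun y ↦ f (V y)) ≤ b) →
    ∀ E, Insensitive a E → mean (E.indicator f) ≤ (b + r) * dens E + β

lemma mean_indicator_le_dens {γ : Type} [Finite γ] {f : γ → ℝ} (hf : ∀ x, f x ≤ 1) (E : Set γ) :
    mean (E.indicator f) ≤ dens E :=
  mean_mono fun x ↦ Set.indicator_le_indicator (hf x)

lemma mean_indicator_subspace_prod {K : Type} [Finite K] (V : Subspace η K ι)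
    (F : Set (κ → K)) (f : (ι ⊕ κ → K) → ℝ) :
    mean ({z | z ∘ Sum.inl ∈ Set.range V ∧ z ∘ Sum.inr ∈ F}.indicator f) =
      (Nat.card (η → K) / Nat.card (ι → K) : ℝ) *
        mean (F.indicator fun y ↦ mean fun w ↦ f (Sum.elim (V w) y)) := by
  classical
  have h1 : mean (F.indicator fun y ↦ mean fun w ↦ f (Sum.elim (V w) y)) =
      mean fun w ↦ mean fun y ↦ F.indicator (fun y ↦ f (Sum.elim (V w) y)) y := by
    rw [mean_comm]
    congr 1
    ext y
    by_cases hy : y ∈ F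
    · simp [hy]
    · simp only [Set.indicator, hy, if_false]
      exact (mul_zero (0 : ℝ) ▸ mean_const_mul (β := η → K) 0 (fun _ ↦ 0) |>.trans (by simp)).symm
  rw [h1, ← mean_indicator_range V (subspace_injective V)
    (fun x ↦ mean fun y ↦ F.indicator (fun y ↦ f (Sum.elim x y)) y), mean_sumElim]
  congr 1
  ext x
  by_cases hx : x ∈ Set.range V
  · rw [Set.indicator_of_mem hx]
    congr 1
    ext y
    simp only [Set.indicator, Set.mem_ofPred_eq, Sum.elim_comp_inl, Sum.elim_comp_inr, hx, true_and]
  · rw [Set.indicator_of_notMem hx]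
    simp only [Set.indicator, Set.mem_ofPred_eq, Sum.elim_comp_inl, hx, false_and, if_false]
    simpa using mean_const_mul (β := κ → K) 0 (fun _ ↦ 0)

lemma InsensitiveBound.step {a : α} {r β : ℝ} (hr : 0 ≤ r) (hβ : 0 < β)
    (hι : ∀ E : Set (ι → Option α), Insensitive a E → β / 2 ≤ dens E →
      ∃ V : Subspace η (Option α) ι, ∀ y, V y ∈ E)
    {c : ℝ} (hc0 : 0 ≤ c)
    (hc : c ≤ (Nat.card (η → Option α) / Nat.card (ι → Option α) : ℝ) *
      (β / 2 / (Nat.card (Subspace η (Option α) ι) + 1)))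
    (hc1 : c ≤ 1) (h : InsensitiveBound η κ a r β) :
    InsensitiveBound η (ι ⊕ κ) a (r * (1 - c)) β := by
  classical
  intro f hf b hb hV E hE
  have hc1' : 0 ≤ 1 - c := by linarith
  have hE0 := dens_nonneg E
  by_cases hdE : dens E < β
  · have h1 := mean_indicator_le_dens hf E
    have : 0 ≤ (b + r * (1 - c)) * dens E := by positivity
    linarith
  push Not at hdE
  have hdE' := hdE
  rw [dens_sumElim] at hdE'
  obtain ⟨V, hdF⟩ := exists_le_dens_of_subset_iUnion (by positivity)
    (half_le_dens_of_le_mean (fun _ ↦ dens_le_one _) hβ.le hdE')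
    (F := fun V : Subspace η (Option α) ι ↦ {y | ∀ w, Sum.elim (V w) y ∈ E})
    (fun y hy ↦ Set.mem_iUnion.2 (hι {x | Sum.elim x y ∈ E} (fun x x' hxx' hx ↦
      hE _ _ (by rintro (i | j); exacts [hxx' i, rfl]) hx) hy))
  set F : Set (κ → Option α) := {y | ∀ w, Sum.elim (V w) y ∈ E} with hF
  set U : Set (ι ⊕ κ → Option α) := {z | z ∘ Sum.inl ∈ Set.range V ∧ z ∘ Sum.inr ∈ F} with hU
  set ρ : ℝ := Nat.card (η → Option α) / Nat.card (ι → Option α) with hρ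
  have hρ0 : 0 ≤ ρ := by positivity
  have hUE : U ⊆ E := by
    rintro z ⟨⟨w, hw⟩, hz⟩
    have := hz w
    rwa [hw, Sum.elim_comp_inl_inr] at this
  have hdU : dens U = ρ * dens F := by
    rw [dens, mean_indicator_subspace_prod V F]
    simp only [mean_const]
    rfl
  have hcU : c ≤ dens U := hc.trans (by rw [hdU]; gcongr)
  have hfU : mean (U.indicator f) ≤ b * dens U := by
    rw [hdU, mean_indicator_subspace_prod V F, mul_left_comm]
    gcongr
    rw [dens, ← mean_const_mul]
    refine mean_mono fun y ↦ ?_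
    by_cases hy : y ∈ F
    · simp only [Set.indicator, hy, if_true, mul_one]
      refine le_of_eq_of_le ?_ (hV (comp (fixRight y) V))
      simp only [comp_apply, fixRight_apply]
    · simp [Set.indicator, hy]
  have hsplit (g : (ι ⊕ κ → Option α) → ℝ) :
      mean (E.indicator g) = mean (U.indicator g) + mean ((E \ U).indicator g) := by
    rw [← mean_add]
    congr 1
    ext z
    by_cases hz : z ∈ U
    · simp [Set.indicator, hz, hUE hz]
    · by_cases hz' : z ∈ E <;> simp [Set.indicator, hz, hz']
  have hrest : mean ((E \ U).indicator f) ≤ (b + r) * dens (E \ U) + β := by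
    rw [dens, mean_sumElim, mean_sumElim, ← mean_const_mul,
      ← mean_const (β := ι → Option α) β, ← mean_add]
    refine mean_mono fun x ↦ ?_
    refine h (fun y ↦ f (Sum.elim x y)) (fun y ↦ hf _) b hb (fun W ↦ ?_)
      {y | Sum.elim x y ∈ E \ U} ?_
    · refine le_of_eq_of_le ?_ (hV (comp (fixLeft x) W))
      simp only [comp_apply, fixLeft_apply]
    · rintro y y' hyy' ⟨hyE, hyU⟩
      refine ⟨hE _ _ (by rintro (i | j); exacts [rfl, hyy' j]) hyE, fun hy'U ↦ hyU ?_⟩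
      refine ⟨by simpa using hy'U.1, ?_⟩
      simp only [Sum.elim_comp_inr]
      intro w
      have := hy'U.2 w
      simp only [Sum.elim_comp_inr] at this
      exact hE _ _ (by rintro (i | j); exacts [rfl, (hyy' j).symm]) this
  have hdsplit : dens E = dens U + dens (E \ U) := hsplit _
  have hdE1 := dens_le_one E
  rw [hsplit f]
  have h1 : c * dens E ≤ dens U := (mul_le_of_le_one_right hc0 hdE1).trans hcU
  have h2 : r * (c * dens E) ≤ r * dens U := by gcongr
  nlinarith

lemma exists_mean_indicator_le_of_insensitive (η : Type) [Finite η] (a : α) (h : DHJ Unit α)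
    {β : ℝ} (hβ : 0 < β) :
    ∃ (ι : Type) (_ : Finite ι), ∀ f : (ι → Option α) → ℝ, (∀ x, f x ≤ 1) → ∀ b : ℝ, 0 ≤ b →
      (∀ V : Subspace η (Option α) ι, mean (fun y ↦ f (V y)) ≤ b) →
      ∀ E, Insensitive a E → mean (E.indicator f) ≤ b + β := by
  have : Nonempty α := ⟨a⟩
  obtain ⟨ι₁, _, h₁⟩ := exists_subspace_of_insensitive a (h.multidimensional η)
    (show (0 : ℝ) < β / 2 / 2 by positivity)
  set c : ℝ := min ((Nat.card (η → Option α) / Nat.card (ι₁ → Option α) : ℝ) *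
      (β / 2 / 2 / (Nat.card (Subspace η (Option α) ι₁) + 1))) 1 with hc
  have hcpos : 0 < c := by
    have : (0 : ℝ) < Nat.card (η → Option α) := by exact_mod_cast Nat.card_pos
    have : (0 : ℝ) < Nat.card (ι₁ → Option α) := by exact_mod_cast Nat.card_pos
    refine lt_min (by positivity) one_pos
  have hc1 : c ≤ 1 := min_le_right _ _
  have key (s : ℕ) : ∃ (ι : Type) (_ : Finite ι),
      InsensitiveBound η ι a ((1 - c) ^ s) (β / 2) := by
    induction s with
    | zero =>
      refine ⟨Empty, inferInstance, fun f hf b hb _ E _ ↦ ?_⟩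
      have := mean_indicator_le_dens hf E
      have := mul_nonneg hb (dens_nonneg E)
      rw [pow_zero]
      linarith
    | succ s ih =>
      obtain ⟨κ, _, hκ⟩ := ih
      refine ⟨ι₁ ⊕ κ, inferInstance, ?_⟩
      rw [pow_succ]
      exact InsensitiveBound.step (pow_nonneg (by linarith) s) (by positivity) h₁ hcpos.le
        (min_le_left _ _) hc1 hκ
  obtain ⟨s, hs⟩ := exists_pow_lt_of_lt_one (show (0 : ℝ) < β / 2 by positivity)
    (show 1 - c < 1 by linarith)
  obtain ⟨ι, _, hι⟩ := key s
  refine ⟨ι, ‹_›, fun f hf b hb hV E hE ↦ ?_⟩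
  have h2 := hι f hf b hb hV E hE
  have h3 : 0 ≤ (1 - c) ^ s := pow_nonneg (by linarith) s
  have h4 : (b + (1 - c) ^ s) * dens E ≤ (b + (1 - c) ^ s) * 1 := by
    gcongr
    exact dens_le_one E
  linarith

lemma exists_mean_indicator_le_of_iInter (h : DHJ Unit α) (s : Finset α) :
    ∀ (η : Type) [Finite η] {β : ℝ}, 0 < β →
    ∃ (ι : Type) (_ : Finite ι), ∀ f : (ι → Option α) → ℝ, (∀ x, f x ≤ 1) → ∀ b : ℝ, 0 ≤ b →
      (∀ V : Subspace η (Option α) ι, mean (fun y ↦ f (V y)) ≤ b) →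
      ∀ E : α → Set (ι → Option α), (∀ a, Insensitive a (E a)) →
        mean ((⋂ a ∈ s, E a).indicator f) ≤ b + β := by
  classical
  induction s using Finset.induction_on with
  | empty =>
    intro η _ β hβ
    refine ⟨η, inferInstance, fun f hf b hb hV E hE ↦ ?_⟩
    have := hV default
    have h2 : (⋂ a ∈ (∅ : Finset α), E a).indicator f = fun y ↦
      f ((default : Subspace η (Option α) η) y) := by
      ext y
      simp
      rfl
    rw [h2]
    linarith
  | insert a s has ih =>
    intro η _ β hβ
    obtain ⟨κ, _, hκ⟩ := ih η (half_pos hβ)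
    obtain ⟨ι, _, hι⟩ := exists_mean_indicator_le_of_insensitive κ a h (half_pos hβ)
    refine ⟨ι, ‹_›, fun f hf b hb hV E hE ↦ ?_⟩
    rw [Finset.set_biInter_insert, ← Set.indicator_indicator]
    refine (hι ((⋂ a ∈ s, E a).indicator f) (fun x ↦ ?_) (b + β / 2) (by positivity) (fun V ↦ ?_)
      (E a) (hE a)).trans_eq (by ring)
    · exact Set.indicator_apply_le' (fun _ ↦ hf x) fun _ ↦ zero_le_one
    · refine le_of_eq_of_le ?_ (hκ (fun y ↦ f (V y)) (fun y ↦ hf _) b hb (fun W ↦ ?_)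
        (fun a ↦ {y | V y ∈ E a}) fun a ↦ (hE a).preimage V)
      · congr 1
        ext y
        simp [Set.indicator]
      · refine le_of_eq_of_le ?_ (hV (comp V W))
        simp only [comp_apply]

end Increment

section Induction

variable {α : Type} [Finite α]

lemma DenseContains.mono {η ι : Type} [Finite ι] {δ δ' : ℝ} (h : DenseContains η α ι δ)
    (hδ : δ ≤ δ') : DenseContains η α ι δ' :=
  fun A hA ↦ h A (hδ.trans hA)

lemma le_card_mul_mean {β : Type} [Finite β] {g : β → ℝ} (hg : ∀ x, 0 ≤ g x) (x : β) :
    g x ≤ Nat.card β * mean g := by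
  have := Fintype.ofFinite β
  have : Nonempty β := ⟨x⟩
  have : (Nat.card β : ℝ) ≠ 0 := by exact_mod_cast Nat.card_pos.ne'
  rw [mean_eq, mul_div_cancel₀ _ this]
  exact Finset.single_le_sum (fun y _ ↦ hg y) (Finset.mem_univ x)

/-- A set without subspaces all of whose sections have almost critical density. -/
lemma exists_dense_sections [Nonempty α] {η : Type} {δ₀ : ℝ}
    (hup : ∀ ε : ℝ, 0 < ε → ∃ (ι : Type) (_ : Finite ι), DenseContains η α ι (δ₀ + ε))
    (hlow : ∀ δ : ℝ, δ < δ₀ → ∀ (ι : Type) [Finite ι], ¬ DenseContains η α ι δ)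
    (ι : Type) [Finite ι] {ε : ℝ} (hε : 0 < ε) :
    ∃ (κ : Type) (_ : Finite κ) (A : Set (ι ⊕ κ → α)),
      (∀ V : Subspace η α (ι ⊕ κ), ∃ y, V y ∉ A) ∧
      ∀ t : ι → α, δ₀ - ε ≤ dens {z : κ → α | Sum.elim t z ∈ A} := by
  obtain ⟨n, hn⟩ : ∃ n : ℝ, n = Nat.card (ι → α) := ⟨_, rfl⟩
  have hn0 : 0 ≤ n := hn ▸ Nat.cast_nonneg _
  set ε' : ℝ := ε / (2 * (n + 1)) with hε'
  have hε'0 : 0 < ε' := by positivity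
  have hεε' : ε = 2 * (n + 1) * ε' := by
    rw [hε']
    field_simp
  obtain ⟨κ, _, hκ⟩ := hup ε' hε'0
  have hex : ∃ A : Set (ι ⊕ κ → α), δ₀ - ε' ≤ dens A ∧
      ∀ V : Subspace η α (ι ⊕ κ), ∃ y, V y ∉ A := by
    have := hlow (δ₀ - ε') (by linarith) (ι ⊕ κ)
    unfold DenseContains at this
    push Not at this
    exact this
  obtain ⟨A, hA, hno⟩ := hex
  refine ⟨κ, ‹_›, A, hno, fun t ↦ ?_⟩
  have hlt (t : ι → α) : 0 ≤ δ₀ + ε' - dens {z : κ → α | Sum.elim t z ∈ A} := by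
    by_contra! hlt
    obtain ⟨V, hV⟩ := hκ {z : κ → α | Sum.elim t z ∈ A} (by linarith)
    obtain ⟨y, hy⟩ := hno (comp (fixLeft t) V)
    rw [comp_apply, fixLeft_apply] at hy
    exact hy (hV y)
  have h1 := le_card_mul_mean hlt t
  have h2 : dens A = mean fun t ↦ dens {z : κ → α | Sum.elim t z ∈ A} := by
    rw [dens, mean_sumElim]
    rfl
  rw [mean_sub, mean_const, ← h2] at h1
  have h3 : n * (δ₀ + ε' - dens A) ≤ n * (2 * ε') := by
    gcongr
    linarith
  rw [← hn] at h1
  nlinarith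

/-- The word over `Option α` obtained by substituting `c` for the wildcard of a line over `α`. -/
def lineWord {η : Type} (l : Subspace Unit α η) (c : Option α) (j : η) : Option α :=
  (l.idxFun j).elim some fun _ ↦ c

/-- Replace each letter `none` in the block of `l` by a letter of `y` depending on `l`, and
append `y`. -/
def blockWord {η ι L : Type} (p : L → η) (u : L → ι → Option α) (y : η → Option α) :
    (L × ι) ⊕ η → Option α :=
  Sum.elim (fun q ↦ (u q.1 q.2).elim (y (p q.1)) some) y

/-- A set without lines in the critical range of densities is disjoint from a dense intersection of
insensitive sets. -/
lemma exists_disjoint_insensitive [Nonempty α] (h : DHJ Unit α) {δ₀ : ℝ} (hδ₀ : 0 < δ₀)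
    (hup : ∀ ε : ℝ, 0 < ε → ∃ (ι : Type) (_ : Finite ι), DenseContains Unit (Option α) ι (δ₀ + ε))
    (hlow : ∀ δ : ℝ, δ < δ₀ → ∀ (ι : Type) [Finite ι], ¬ DenseContains Unit (Option α) ι δ) :
    ∃ θ : ℝ, 0 < θ ∧ ∀ ε : ℝ, 0 < ε → ε ≤ δ₀ / 2 → ∀ (ι : Type) [Finite ι],
      ∃ (A : Set (ι → Option α)) (D : α → Set (ι → Option α)),
        (∀ V : Subspace Unit (Option α) ι, ∃ y, V y ∉ A) ∧ (∀ a, Insensitive a (D a)) ∧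
        Disjoint A (⋂ a, D a) ∧ δ₀ - ε + δ₀ * θ ≤ dens A + δ₀ * dens (⋂ a, D a) := by
  classical
  obtain ⟨η, _, hη⟩ := h (δ₀ / 2 / 2) (by positivity)
  let L := Subspace Unit α η
  have : Finite L := inferInstanceAs (Finite (Subspace Unit α η))
  refine ⟨δ₀ / 2 / 2 / (Nat.card L + 1), by positivity, fun ε hε hεδ ι _ ↦ ?_⟩
  choose p hp using fun l : L ↦ l.proper ()
  obtain ⟨κ, _, A, hno, hA⟩ := exists_dense_sections hup hlow ((L × ι) ⊕ η) hε
  have hmean : δ₀ / 2 ≤ mean fun q : (L → ι → Option α) × (κ → Option α) ↦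
      dens {t : η → α | Sum.elim (blockWord p q.1 (some ∘ t)) q.2 ∈ A} := by
    rw [mean_prod]
    refine le_mean fun u ↦ ?_
    simp only [dens]
    rw [mean_comm]
    exact le_mean fun t ↦ le_trans (by linarith) (hA (blockWord p u (some ∘ t)))
  obtain ⟨l, hl⟩ := exists_le_dens_of_subset_iUnion (by positivity)
    (half_le_dens_of_le_mean (fun _ ↦ dens_le_one _) (by positivity) hmean)
    (F := fun l : L ↦ {q | ∀ a, Sum.elim (blockWord p q.1 (lineWord l (some a))) q.2 ∈ A})
    (fun q hq ↦ by
      obtain ⟨l, hl⟩ := hη _ hq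
      refine Set.mem_iUnion.2 ⟨l, fun a ↦ ?_⟩
      convert Set.mem_ofPred_eq ▸ hl fun _ ↦ a using 3
      ext1 j
      cases hj : l.idxFun j <;> simp [lineWord, Subspace.coe_apply, hj])
  set A' : (L → ι → Option α) × (κ → Option α) → Set (ι → Option α) := fun q ↦
    {x | Sum.elim (blockWord p (Function.update q.1 l x) (lineWord l none)) q.2 ∈ A} with hA'
  set D : (L → ι → Option α) × (κ → Option α) → α → Set (ι → Option α) := fun q a ↦
    {x | Sum.elim (blockWord p (Function.update q.1 l x) (lineWord l (some a))) q.2 ∈ A} with hD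
  have hmA : δ₀ - ε ≤ mean fun q ↦ dens (A' q) := by
    rw [mean_prod]
    refine le_mean fun u ↦ ?_
    simp only [dens]
    rw [mean_comm]
    exact le_mean fun x ↦ hA (blockWord p (Function.update u l x) (lineWord l none))
  have hmD : dens {q : (L → ι → Option α) × (κ → Option α) |
      ∀ a, Sum.elim (blockWord p q.1 (lineWord l (some a))) q.2 ∈ A} =
        mean fun q ↦ dens (⋂ a, D q a) := by
    rw [dens_prod, mean_update l, mean_prod]
    congr 1
    ext u
    simp only [dens]
    rw [mean_comm]
    congr 1
    ext ω
    congr 1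
    ext x
    simp [Set.indicator, hD]
  rw [hmD] at hl
  obtain ⟨q, hq⟩ := exists_le_of_le_mean (f := fun q ↦ dens (A' q) + δ₀ * dens (⋂ a, D q a))
    (c := δ₀ - ε + δ₀ * (δ₀ / 2 / 2 / (Nat.card L + 1))) (by
      rw [mean_add, mean_const_mul]
      gcongr)
  refine ⟨A' q, D q, fun V ↦ ?_, fun a x x' hxx' hx ↦ ?_, ?_, hq⟩
  · let Q : Subspace ι (Option α) (((L × ι) ⊕ η) ⊕ κ) :=
      { idxFun := Sum.elim (Sum.elim
          (fun r ↦ if r.1 = l then Sum.inr r.2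
            else Sum.inl ((q.1 r.1 r.2).elim (lineWord l none (p r.1)) some))
          fun j ↦ Sum.inl (lineWord l none j)) fun z ↦ Sum.inl (q.2 z)
        proper := fun i ↦ ⟨Sum.inl (Sum.inl (l, i)), by simp⟩ }
    have hQ (x : ι → Option α) :
        Q x = Sum.elim (blockWord p (Function.update q.1 l x) (lineWord l none)) q.2 := by
      ext1 (((⟨l', i⟩ | j) | z))
      · rcases eq_or_ne l' l with rfl | hne
        · have : lineWord l' none (p l') = none := by simp [lineWord, hp]
          cases hx : x i <;> simp [Q, Subspace.coe_apply, blockWord, this, hx]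
        · simp [Q, Subspace.coe_apply, blockWord, hne]
      · simp [Q, Subspace.coe_apply, blockWord]
      · simp [Q, Subspace.coe_apply]
    obtain ⟨y, hy⟩ := hno (comp Q V)
    rw [comp_apply, hQ] at hy
    exact ⟨y, hy⟩
  · have : blockWord p (Function.update q.1 l x) (lineWord l (some a)) =
        blockWord p (Function.update q.1 l x') (lineWord l (some a)) := by
      ext1 ((⟨l', i⟩ | j))
      · rcases eq_or_ne l' l with rfl | hne
        · have hw : lineWord l' (some a) (p l') = some a := by simp [lineWord, hp]
          have hi := hxx' i
          cases hx : x i <;> cases hx' : x' i <;> simp_all [blockWord]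
        · simp [blockWord, hne]
      · rfl
    simpa only [hD, Set.mem_ofPred_eq, this] using hx
  · rw [Set.disjoint_left]
    intro x hxA hxD
    let V : Subspace Unit (Option α) (((L × ι) ⊕ η) ⊕ κ) :=
      { idxFun := Sum.elim (Sum.elim
          (fun r ↦ (Function.update q.1 l x r.1 r.2).elim ((l.idxFun (p r.1)).map some id)
            fun a ↦ Sum.inl (some a))
          fun j ↦ (l.idxFun j).map some id) fun z ↦ Sum.inl (q.2 z)
        proper := fun _ ↦ ⟨Sum.inl (Sum.inr (p l)), by simp [hp]⟩ }
    have hV (y : Unit → Option α) :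
        V y = Sum.elim (blockWord p (Function.update q.1 l x) (lineWord l (y ()))) q.2 := by
      have hline (j : η) :
          ((l.idxFun j).map some id).elim id y = lineWord l (y ()) j := by
        cases hj : l.idxFun j <;> simp [lineWord, hj]
      ext1 (((⟨l', i⟩ | j) | z))
      · cases hx : Function.update q.1 l x l' i <;>
          simp [V, Subspace.coe_apply, blockWord, hx, hline]
      · simp [V, Subspace.coe_apply, blockWord, hline]
      · simp [V, Subspace.coe_apply]
    obtain ⟨y, hy⟩ := hno V
    rw [hV] at hy
    cases hc : y () with
    | none => exact hy (by rw [hc]; exact hxA)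
    | some a => exact hy (by rw [hc]; exact Set.mem_iInter.1 hxD a)

/-- Density Hales-Jewett passes to an alphabet with one more letter. -/
theorem DHJ.option [Nonempty α] (h : DHJ Unit α) : DHJ Unit (Option α) := by
  classical
  have := Fintype.ofFinite α
  by_contra hcon
  unfold DHJ at hcon
  push Not at hcon
  obtain ⟨δ₁, hδ₁, hcon⟩ := hcon
  set S : Set ℝ := {δ | ∃ (ι : Type) (_ : Finite ι), DenseContains Unit (Option α) ι δ} with hS
  have hlb : ∀ δ ∈ S, δ₁ ≤ δ := by
    rintro δ ⟨ι, _, hι⟩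
    by_contra! hlt
    exact hcon ι ‹_› (hι.mono hlt.le)
  have hSne : S.Nonempty := ⟨2, Empty, inferInstance, fun A hA ↦ by
    linarith [dens_le_one A]⟩
  have hbdd : BddBelow S := ⟨δ₁, hlb⟩
  set δ₀ := sInf S with hδ₀
  have hδ₀pos : 0 < δ₀ := hδ₁.trans_le (le_csInf hSne hlb)
  have hup (ε : ℝ) (hε : 0 < ε) :
      ∃ (ι : Type) (_ : Finite ι), DenseContains Unit (Option α) ι (δ₀ + ε) := by
    obtain ⟨δ, ⟨ι, hfin, hι⟩, hδ⟩ := exists_lt_of_csInf_lt hSne (show sInf S < δ₀ + ε by linarith)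
    exact ⟨ι, hfin, hι.mono hδ.le⟩
  have hlow (δ : ℝ) (hδ : δ < δ₀) (ι : Type) [Finite ι] :
      ¬ DenseContains Unit (Option α) ι δ :=
    fun hι ↦ (csInf_le hbdd ⟨ι, ‹_›, hι⟩).not_gt hδ
  obtain ⟨θ, hθ, hcorr⟩ := exists_disjoint_insensitive h hδ₀pos hup hlow
  set ε : ℝ := min (δ₀ * θ / 4) (δ₀ / 2) with hεdef
  have hε : 0 < ε := lt_min (by positivity) (by positivity)
  have hεθ : ε ≤ δ₀ * θ / 4 := min_le_left _ _
  obtain ⟨κ, _, hκ⟩ := hup ε hε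
  set β : ℝ := δ₀ * θ / 4 / (Fintype.card (Finset α) + 1) with hβdef
  have hβ : 0 < β := by positivity
  obtain ⟨ι, _, hι⟩ := exists_mean_indicator_le_of_iInter h Finset.univ κ hβ
  obtain ⟨A, D, hno, hD, hdisj, hdens⟩ := hcorr ε hε (min_le_right _ _) ι
  set f : (ι → Option α) → ℝ := fun x ↦ A.indicator (fun _ ↦ 1) x - (δ₀ + ε) with hf
  have hf1 (x) : f x ≤ 1 := by
    have : A.indicator (fun _ ↦ (1 : ℝ)) x ≤ 1 := Set.indicator_apply_le' (fun _ ↦ le_rfl)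
      fun _ ↦ zero_le_one
    simp only [hf]
    linarith
  have hfV (V : Subspace κ (Option α) ι) : mean (fun y ↦ f (V y)) ≤ 0 := by
    simp only [hf]
    rw [mean_sub, mean_const]
    by_contra! hlt
    obtain ⟨W, hW⟩ := hκ {y | V y ∈ A} (sub_pos.1 hlt).le
    obtain ⟨y, hy⟩ := hno (comp V W)
    rw [comp_apply] at hy
    exact hy (hW y)
  have hcells (T : Finset α) :
      mean ((⋂ a ∈ (Finset.univ : Finset α), if a ∈ T then D a else (D a)ᶜ).indicator f) ≤ β := by
    refine (hι f hf1 0 le_rfl hfV _ fun a ↦ ?_).trans_eq (zero_add β)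
    split_ifs
    · exact hD a
    · exact fun x y hxy hx hy ↦ hx (hD a _ _ (fun i ↦ (hxy i).symm) hy)
  have hsum : mean ((⋂ a, D a)ᶜ.indicator f) ≤ ∑ _T : Finset α, β := by
    have hpart : (⋂ a, D a)ᶜ.indicator f = fun x ↦ ∑ T ∈ Finset.univ.erase (Finset.univ : Finset α),
        (⋂ a ∈ (Finset.univ : Finset α), if a ∈ T then D a else (D a)ᶜ).indicator f x := by
      ext x
      have hmem (T : Finset α) :
          x ∈ (⋂ a ∈ (Finset.univ : Finset α), if a ∈ T then D a else (D a)ᶜ) ↔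
            T = Finset.univ.filter (x ∈ D ·) := by
        simp only [Finset.mem_univ, Set.iInter_true, Set.mem_iInter, Finset.ext_iff,
          Finset.mem_filter, true_and]
        refine forall_congr' fun a ↦ ?_
        by_cases ha : a ∈ T <;> simp [ha]
      simp only [Set.indicator, hmem]
      rw [Finset.sum_ite_eq']
      simp only [Finset.mem_erase, Finset.mem_univ, and_true, ne_eq, Finset.filter_eq_self,
        forall_const, Set.mem_compl_iff, Set.mem_iInter]
    rw [hpart, mean_sum]
    exact (Finset.sum_le_sum fun T _ ↦ hcells T).trans
      (Finset.sum_le_sum_of_subset_of_nonneg (Finset.subset_univ _) fun _ _ _ ↦ hβ.le)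
  have hval : mean ((⋂ a, D a)ᶜ.indicator f) = dens A - (δ₀ + ε) * (1 - dens (⋂ a, D a)) := by
    have : (⋂ a, D a)ᶜ.indicator f = fun x ↦ A.indicator (fun _ ↦ 1) x -
        (δ₀ + ε) * (1 - (⋂ a, D a).indicator (fun _ ↦ 1) x) := by
      ext x
      by_cases hx : x ∈ ⋂ a, D a
      · have hxA : x ∉ A := fun hxA ↦ Set.disjoint_left.1 hdisj hxA hx
        rw [Set.indicator_of_notMem (Set.notMem_compl_iff.2 hx), Set.indicator_of_notMem hxA,
          Set.indicator_of_mem hx]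
        ring
      · rw [Set.indicator_of_mem (show x ∈ (⋂ a, D a)ᶜ from hx), Set.indicator_of_notMem hx]
        simp only [hf]
        ring
    rw [this, mean_sub, mean_const_mul, mean_sub, mean_const]
    rfl
  rw [hval, Finset.sum_const, nsmul_eq_mul, Finset.card_univ] at hsum
  have hβle : (Fintype.card (Finset α) : ℝ) * β < δ₀ * θ / 4 := by
    rw [hβdef, ← mul_div_assoc, div_lt_iff₀ (by positivity)]
    nlinarith [mul_pos hδ₀pos hθ]
  have := mul_nonneg hε.le (dens_nonneg (⋂ a, D a))
  nlinarith [mul_pos hδ₀pos hθ]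

/-- Density Hales-Jewett for lines over an alphabet of any positive size. -/
lemma exists_dhj_card (n : ℕ) : ∃ (K : Type) (_ : Finite K), Nat.card K = n + 1 ∧ DHJ Unit K := by
  induction n with
  | zero =>
    refine ⟨Unit, inferInstance, by simp, fun δ hδ ↦ ⟨Unit, inferInstance, fun A hA ↦ ?_⟩⟩
    obtain ⟨x, hx⟩ := nonempty_of_dens_pos (hδ.trans_le hA)
    exact ⟨default, fun y ↦ by convert hx⟩
  | succ n ih =>
    obtain ⟨K, _, hK, h⟩ := ih
    have : Nonempty K := (Nat.card_pos_iff.1 (by omega)).1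
    exact ⟨Option K, inferInstance, by rw [Finite.card_option, hK], h.option⟩

end Induction

section Recurrence

/-- Multiple recurrence for a commuting family of measure-preserving maps. -/
lemma exists_iterate_mem {X M K : Type*} [MeasurableSpace X] {μ : Measure X}
    [IsProbabilityMeasure μ] [CommMonoid M] {φ : M →* Function.End X}
    (hφ : ∀ m, MeasurePreserving (φ m) μ μ) {L : Type} [Finite L] [Nonempty L] (hL : DHJ Unit L)
    (e : L ≃ K) (τ : K → M) {B : Set X} (hB : MeasurableSet B) (hB0 : μ B ≠ 0) :
    ∃ (y : X) (n : ℕ), 1 ≤ n ∧ ∀ c, φ (τ c ^ n) y ∈ B := by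
  classical
  obtain ⟨ι, _, hι⟩ := hL (μ.real B) (ENNReal.toReal_pos hB0 (measure_ne_top μ B))
  have := Fintype.ofFinite ι
  have := Fintype.ofFinite L
  let S : (ι → L) → M := fun w ↦ ∏ i, τ (e (w i))
  obtain ⟨x, hx⟩ : ∃ x, μ.real B ≤ dens {w | φ (S w) x ∈ B} := by
    have hint (w : ι → L) : Integrable ((φ (S w) ⁻¹' B).indicator fun _ ↦ (1 : ℝ)) μ :=
      (integrable_const 1).indicator ((hφ _).measurable hB)
    have hdens (x : X) : dens {w | φ (S w) x ∈ B} =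
        (∑ w, (φ (S w) ⁻¹' B).indicator (fun _ ↦ (1 : ℝ)) x) / Nat.card (ι → L) := by
      rw [dens, mean_eq]
      rfl
    have hc : (Nat.card (ι → L) : ℝ) ≠ 0 := by exact_mod_cast Nat.card_pos.ne'
    obtain ⟨x, hx⟩ := exists_integral_le
      ((integrable_finsetSum Finset.univ fun w _ ↦ hint w).div_const (Nat.card (ι → L) : ℝ))
    refine ⟨x, ?_⟩
    rw [hdens]
    refine le_of_eq_of_le ?_ hx
    rw [integral_div, integral_finsetSum _ fun w _ ↦ hint w]
    have hval (w : ι → L) :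
        ∫ x, (φ (S w) ⁻¹' B).indicator (fun _ ↦ (1 : ℝ)) x ∂μ = μ.real B := by
      rw [integral_indicator_const _ ((hφ _).measurable hB), smul_eq_mul, mul_one,
        measureReal_def, (hφ _).measure_preimage hB.nullMeasurableSet, measureReal_def]
    simp only [hval, Finset.sum_const, Finset.card_univ, nsmul_eq_mul,
      ← Nat.card_eq_fintype_card]
    field_simp
  obtain ⟨V, hV⟩ := hι _ hx
  let F : ι → M := fun i ↦ (V.idxFun i).elim (fun c ↦ τ (e c)) fun _ ↦ 1
  let s : Finset ι := Finset.univ.filter fun i ↦ V.idxFun i = Sum.inr ()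
  obtain ⟨i₀, hi₀⟩ := V.proper ()
  refine ⟨φ (∏ i, F i) x, s.card, Finset.card_pos.2 ⟨i₀, by simp [s, hi₀]⟩, fun c ↦ ?_⟩
  have hS : S (V fun _ ↦ e.symm c) = τ c ^ s.card * ∏ i, F i := by
    rw [← Finset.prod_const, Finset.prod_filter, ← Finset.prod_mul_distrib]
    refine Finset.prod_congr rfl fun i _ ↦ ?_
    cases hi : V.idxFun i <;> simp [F, Subspace.coe_apply, hi]
  have := hV fun _ ↦ e.symm c
  rw [Set.mem_ofPred_eq, hS, map_mul] at this
  exact this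

open scoped IsMulCommutative in
lemma exists_mem_iterate_mem {X : Type*} [MeasurableSpace X] {μ : Measure X}
    [IsProbabilityMeasure μ] {k : ℕ} {T : Fin k → X → X} (hT : ∀ i, MeasurePreserving (T i) μ μ)
    (hcomm : ∀ i j, T i ∘ T j = T j ∘ T i) {B : Set X} (hB : MeasurableSet B) (hB0 : μ B ≠ 0) :
    ∃ y ∈ B, ∃ n : ℕ, 1 ≤ n ∧ ∀ i, (T i)^[n] y ∈ B := by
  let t : Fin k → Function.End X := T
  have := Submonoid.isMulCommutative_closure (Function.End X) (s := Set.range t)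
    (Set.forall_mem_range.2 fun i ↦ Set.forall_mem_range.2 fun j ↦ hcomm i j)
  have hφ (m : Submonoid.closure (Set.range t)) :
      MeasurePreserving ((Submonoid.closure (Set.range t)).subtype m) μ μ := by
    obtain ⟨m, hm⟩ := m
    induction hm using Submonoid.closure_induction with
    | mem m hm =>
      obtain ⟨i, rfl⟩ := hm
      exact hT i
    | one => exact MeasurePreserving.id μ
    | mul f g _ _ hf hg =>
      have := hf.comp hg
      exact this
  obtain ⟨L, _, hcard, hL⟩ := exists_dhj_card k
  obtain ⟨e⟩ : Nonempty (L ≃ Option (Fin k)) := Finite.card_eq.1 (by simp [hcard])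
  have : Nonempty L := ⟨e.symm none⟩
  obtain ⟨y, n, hn, hy⟩ := exists_iterate_mem hφ hL e
    (fun c ↦ c.elim 1 fun i ↦ ⟨t i, Submonoid.subset_closure ⟨i, rfl⟩⟩) hB hB0
  refine ⟨y, ?_, n, hn, fun i ↦ ?_⟩
  · have := hy none
    rw [Option.elim_none, one_pow, map_one] at this
    exact this
  · exact hy (some i)

end Recurrence

end DensityHalesJewett

/-- If pairwise commuting measurable measure-preserving maps `T 1, …, T k` on a probability
space satisfy the set form of multiple recurrence (for every measurable `B` of positive
measure there is `n ≥ 1` with `μ (⋂ i, (T i)^{-n} B) > 0`), then for every measurable `A`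
with `μ A > 0` and almost every `x ∈ A` there is `n ≥ 1` with `x ∈ ⋂ i, (T i)^{-n} A`. -/
theorem pointwise_recurrence_of_set_recurrence {X : Type*} [MeasurableSpace X] (μ : Measure X)
    [IsProbabilityMeasure μ] (k : ℕ) (hk : 1 ≤ k) (T : Fin k → X → X)
    (hTmeas : ∀ i, Measurable (T i))
    (hTpres : ∀ i, ∀ A : Set X, MeasurableSet A → μ (T i ⁻¹' A) = μ A)
    (hTcomm : ∀ i j, T i ∘ T j = T j ∘ T i)
    (hrec : ∀ B : Set X, MeasurableSet B → 0 < μ B →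
      ∃ n : ℕ, 1 ≤ n ∧ 0 < μ (⋂ i : Fin k, (T i)^[n] ⁻¹' B)) :
    ∀ A : Set X, MeasurableSet A → 0 < μ A →
      ∀ᵐ x ∂μ, x ∈ A → ∃ n : ℕ, 1 ≤ n ∧ x ∈ ⋂ i : Fin k, (T i)^[n] ⁻¹' A := by
  intro A hA _
  have hmeas : MeasurableSet {x ∈ A | ¬ ∃ n : ℕ, 1 ≤ n ∧ x ∈ ⋂ i : Fin k, (T i)^[n] ⁻¹' A} := by
    refine hA.inter (MeasurableSet.compl
      (s := {x | ∃ n : ℕ, 1 ≤ n ∧ x ∈ ⋂ i : Fin k, (T i)^[n] ⁻¹' A}) ?_)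
    simp only [Set.ofPred_exists, Set.ofPred_and]
    exact MeasurableSet.iUnion fun n ↦ (MeasurableSet.const _).inter
      (MeasurableSet.iInter fun i ↦ (hTmeas i).iterate n hA)
  have hnull : μ {x ∈ A | ¬ ∃ n : ℕ, 1 ≤ n ∧ x ∈ ⋂ i : Fin k, (T i)^[n] ⁻¹' A} = 0 := by
    by_contra h0
    have hT (i : Fin k) : MeasurePreserving (T i) μ μ :=
      ⟨hTmeas i, Measure.ext fun S hS ↦ by rw [Measure.map_apply (hTmeas i) hS, hTpres i S hS]⟩
    obtain ⟨y, hy, n, hn, hny⟩ :=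
      DensityHalesJewett.exists_mem_iterate_mem hT hTcomm hmeas h0
    exact hy.2 ⟨n, hn, Set.mem_iInter.2 fun i ↦ (hny i).1⟩
  rw [ae_iff]
  simpa only [Classical.not_imp] using hnull
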